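/- arXiv:2408.04087 — 6 statements merged into one kernel-verified Lean document; each statement's English description precedes it below -/
import Mathlib

section
/- For every t ≥ t*, the charge level s is differentiable at t (with the one-sided derivative at t = t* taken from the right) and satisfies s′(t) = −α·s(t) + α·p·t* + p. -/
/-- The charge accumulated during the exponentially decaying phase. -/
theorem integral_mul_exp_neg_mul_sub (p a b : ℝ) {α : ℝ} (hα : α ≠ 0) :
    ∫ τ in a..b, p * Real.exp (-α * (τ - a)) = p / α * (1 - Real.exp (-α * (b - a))) := by
  have hderiv (x : ℝ) : HasDerivAt (fun y => -(p / α) * Real.exp (-α * (y - a)))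
      (p * Real.exp (-α * (x - a))) x := by
    have h := ((((hasDerivAt_id' x).sub_const a).const_mul (-α)).exp).const_mul (-(p / α))
    refine h.congr_deriv ?_
    field_simp
  rw [intervalIntegral.integral_eq_sub_of_hasDerivAt (fun x _ => hderiv x)
    (Continuous.intervalIntegrable (by fun_prop) _ _)]
  simp
  ring


/-- For every `t ≥ t*`, the charge level `s` is differentiable at `t`
(with the derivative at `t = t*` taken one-sidedly from the right, i.e. within `Ici t*`)
and satisfies `s′ t = -α * s t + α * p * t* + p`. -/
theorem cccv_cv_phase_ode
    (p α ηE tstar : ℝ) (hp : 0 < p) (hα : 0 < α) (hηE : 0 < ηE)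
    (htstar : tstar = ηE / p)
    (P : ℝ → ℝ)
    (hPcc : ∀ t, 0 ≤ t → t < tstar → P t = p)
    (hPcv : ∀ t, tstar ≤ t → P t = p * Real.exp (-α * (t - tstar)))
    (s : ℝ → ℝ)
    (hs : ∀ t, 0 ≤ t → s t = ∫ τ in (0:ℝ)..t, P τ) :
    ∀ t, tstar ≤ t →
      HasDerivWithinAt s (-α * s t + α * p * tstar + p) (Set.Ici tstar) t ∧
      (tstar < t → HasDerivAt s (-α * s t + α * p * tstar + p) t) := by
  have htpos : 0 ≤ tstar := htstar ▸ (div_pos hηE hp).le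
  have hcc : Set.EqOn (fun _ => p) P (Set.uIcc 0 tstar) := by
    intro x hx
    rw [Set.uIcc_of_le htpos] at hx
    rcases hx.2.lt_or_eq with h | rfl
    · exact (hPcc x hx.1 h).symm
    · simp [hPcv x le_rfl]
  have hclosed : ∀ t, tstar ≤ t →
      s t = p * tstar + p / α * (1 - Real.exp (-α * (t - tstar))) := by
    intro t ht
    have hcv : Set.EqOn (fun τ => p * Real.exp (-α * (τ - tstar))) P (Set.uIcc tstar t) := by
      intro x hx
      rw [Set.uIcc_of_le ht] at hx
      exact (hPcv x hx.1).symm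
    have hint₁ : IntervalIntegrable P MeasureTheory.volume 0 tstar :=
      (continuousOn_const.congr hcc.symm).intervalIntegrable
    have hint₂ : IntervalIntegrable P MeasureTheory.volume tstar t :=
      (ContinuousOn.congr (by fun_prop) hcv.symm).intervalIntegrable
    rw [hs t (htpos.trans ht), ← intervalIntegral.integral_add_adjacent_intervals hint₁ hint₂,
      ← intervalIntegral.integral_congr hcc, ← intervalIntegral.integral_congr hcv,
      integral_mul_exp_neg_mul_sub p tstar t hα.ne', intervalIntegral.integral_const]
    simp [mul_comm]
  intro t ht
  have hderiv : HasDerivAt (fun t => p * tstar + p / α * (1 - Real.exp (-α * (t - tstar))))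
      (-α * s t + α * p * tstar + p) t := by
    have h := (((((hasDerivAt_id' t).sub_const tstar).const_mul (-α)).exp.const_sub 1).const_mul
      (p / α)).const_add (p * tstar)
    refine h.congr_deriv ?_
    rw [hclosed t ht]
    field_simp
    ring
  refine ⟨hderiv.hasDerivWithinAt.congr hclosed (hclosed t ht), fun hlt => ?_⟩
  exact hderiv.congr_of_eventuallyEq
    ((eventually_gt_nhds hlt).mono fun x hx => hclosed x hx.le)
end

section
/- For every real z ≠ 0, the value f(z) = 1/(exp(−z) − 1) + 1/z satisfies −1 < f(z) < 0. -/
lemma one_div_exp_sub_one_lt_one_div {w : ℝ} (hw : w ≠ 0) :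
    1 / (Real.exp w - 1) < 1 / w := by
  have h : w < Real.exp w - 1 := by linarith [Real.add_one_lt_exp hw]
  rcases hw.lt_or_gt with hneg | hpos
  · exact one_div_lt_one_div_of_neg_of_lt (by linarith [Real.exp_lt_one_iff.mpr hneg]) h
  · exact one_div_lt_one_div_of_lt hpos h

lemma one_div_exp_neg_sub_one {z : ℝ} (hz : z ≠ 0) :
    1 / (Real.exp (-z) - 1) = -1 - 1 / (Real.exp z - 1) := by
  have h : Real.exp z - 1 ≠ 0 := sub_ne_zero.mpr (mt (Real.exp_eq_one_iff z).mp hz)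
  have h' : 1 - Real.exp z ≠ 0 := by rwa [← neg_sub, neg_ne_zero]
  have he := Real.exp_ne_zero z
  rw [Real.exp_neg]
  field_simp
  ring

/-- For every real `z ≠ 0`, the value `f z = 1/(exp (-z) - 1) + 1/z` satisfies
`-1 < f z < 0`. -/
theorem f_bounds (z : ℝ) (hz : z ≠ 0) :
    -1 < 1 / (Real.exp (-z) - 1) + 1 / z ∧
    1 / (Real.exp (-z) - 1) + 1 / z < 0 := by
  constructor
  · rw [one_div_exp_neg_sub_one hz]
    linarith [one_div_exp_sub_one_lt_one_div hz]
  · have h := one_div_exp_sub_one_lt_one_div (neg_ne_zero.mpr hz)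
    rw [one_div_neg_eq_neg_one_div] at h
    linarith
end

section
/- The function f(z) = 1/(exp(−z) − 1) + 1/z is strictly decreasing on (0, ∞); equivalently, for all reals z₁, z₂ with 0 < z₁ < z₂ one has f(z₂) < f(z₁). -/
/-- The inequality `z / 2 < sinh (z / 2)`, squared and rewritten in terms of `exp (-z)`. -/
theorem sq_mul_exp_neg_lt {z : ℝ} (hz : 0 < z) :
    z ^ 2 * Real.exp (-z) < (Real.exp (-z) - 1) ^ 2 := by
  have hsinh : z / 2 < Real.sinh (z / 2) := Real.self_lt_sinh_iff.2 (half_pos hz)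
  rw [Real.sinh_eq, Real.exp_neg] at hsinh
  have hexp : Real.exp (-z) = (Real.exp (z / 2))⁻¹ ^ 2 := by
    rw [← Real.exp_neg, ← Real.exp_nat_mul]
    congr 1
    push_cast
    ring
  set t := Real.exp (z / 2) with ht
  have htpos : 0 < t := Real.exp_pos _
  have hlt : z * t⁻¹ < 1 - t⁻¹ ^ 2 := by
    have h : z * t⁻¹ < (t - t⁻¹) * t⁻¹ :=
      mul_lt_mul_of_pos_right (by linarith) (inv_pos.2 htpos)
    have hmul : t * t⁻¹ = 1 := mul_inv_cancel₀ htpos.ne'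
    linarith
  have hsq := pow_lt_pow_left₀ hlt (by positivity) two_ne_zero
  rw [hexp]
  linarith

/-- The function `f z = 1/(exp (-z) - 1) + 1/z` is strictly decreasing on `(0, ∞)`:
for all reals `z₁, z₂` with `0 < z₁ < z₂`, `f z₂ < f z₁`. -/
theorem f_strictAnti_on_pos :
    StrictAntiOn (fun z : ℝ => 1 / (Real.exp (-z) - 1) + 1 / z) (Set.Ioi (0:ℝ)) ∧
    (∀ z₁ z₂ : ℝ, 0 < z₁ → z₁ < z₂ →
      1 / (Real.exp (-z₂) - 1) + 1 / z₂ < 1 / (Real.exp (-z₁) - 1) + 1 / z₁) := by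
  have hderiv : ∀ z : ℝ, 0 < z →
      HasDerivAt (fun z : ℝ => 1 / (Real.exp (-z) - 1) + 1 / z)
        (Real.exp (-z) / (Real.exp (-z) - 1) ^ 2 - 1 / z ^ 2) z := by
    intro z hz
    have hne : Real.exp (-z) - 1 ≠ 0 :=
      (sub_neg.2 (Real.exp_lt_one_iff.2 (neg_neg_of_pos hz))).ne
    have h := (((hasDerivAt_neg z).exp.sub_const 1).fun_inv hne).add (hasDerivAt_inv hz.ne')
    simp only [one_div]
    exact h.congr_deriv (by ring)
  have hanti : StrictAntiOn (fun z : ℝ => 1 / (Real.exp (-z) - 1) + 1 / z) (Set.Ioi (0:ℝ)) := by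
    refine strictAntiOn_of_deriv_neg (convex_Ioi 0)
      (fun z hz => (hderiv z hz).continuousAt.continuousWithinAt) fun z hz => ?_
    rw [interior_Ioi] at hz
    have hz : 0 < z := hz
    have hlt := sq_mul_exp_neg_lt hz
    have hpos : 0 < (Real.exp (-z) - 1) ^ 2 := lt_of_le_of_lt (by positivity) hlt
    rw [(hderiv z hz).deriv, sub_neg, div_lt_div_iff₀ hpos (by positivity)]
    linarith
  exact ⟨hanti, fun z₁ z₂ h₁ h₂ => hanti h₁ (h₁.trans h₂) h₂⟩
end

section
/- For every discretization step δ > 0, the intersection point s^× = p·δ/(exp(−α·δ) − 1) + p·t* + p/α satisfies 0 < ηE − s^× < p·δ; in particular s^× lies strictly below the true switching charge level ηE, and by no more than b̄cc = p·δ. -/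
/-- For every discretization step `δ > 0`, the intersection point
`s^× = p*δ/(exp (-α*δ) - 1) + p*t* + p/α` satisfies `0 < ηE - s^× < p*δ`:
`s^×` lies strictly below the true switching level `ηE`, by no more than `b̄cc = p*δ`. -/
theorem switching_point_error_bounds
    (p α ηE δ tstar sx : ℝ)
    (hp : 0 < p) (hα : 0 < α) (hηE : 0 < ηE) (hδ : 0 < δ)
    (htstar : tstar = ηE / p)
    (hsx : sx = p * δ / (Real.exp (-α * δ) - 1) + p * tstar + p / α) :
    0 < ηE - sx ∧ ηE - sx < p * δ := by
  have hx : 0 < α * δ := mul_pos hα hδ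
  have hlower : 1 - α * δ < Real.exp (-α * δ) := by
    have := Real.add_one_lt_exp (x := -α * δ) (by linarith)
    linarith
  have hupper : (1 + α * δ) * Real.exp (-α * δ) < 1 := by
    rw [neg_mul, Real.exp_neg, ← div_eq_mul_inv, div_lt_one (Real.exp_pos _)]
    have := Real.add_one_lt_exp hx.ne'
    linarith
  have hlt : Real.exp (-α * δ) < 1 := Real.exp_lt_one_iff.mpr (by linarith)
  generalize Real.exp (-α * δ) = e at *
  have he : 0 < 1 - e := sub_pos.mpr hlt
  have he' : e - 1 ≠ 0 := (sub_neg.mpr hlt).ne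
  have hgap : ηE - sx = p * (α * δ - (1 - e)) / (α * (1 - e)) := by
    rw [hsx, htstar]
    field_simp
    ring
  rw [hgap]
  constructor
  · exact div_pos (mul_pos hp (by linarith)) (mul_pos hα he)
  · rw [div_lt_iff₀ (mul_pos hα he)]
    calc p * (α * δ - (1 - e)) < p * (α * δ * (1 - e)) :=
          mul_lt_mul_of_pos_left (by linarith) hp
      _ = p * δ * (α * (1 - e)) := by ring
end

section
/- Define the maximum gain error gᵉ = (ā − 1)·(ηE − s^×), where ā = exp(−α·δ) and s^× = p·δ/(exp(−α·δ) − 1) + p·t* + p/α. Then gᵉ = −(1 − (1 − exp(−α·δ))/(α·δ))·p·δ, and gᵉ satisfies −p·δ < gᵉ < 0; that is, the maximum gain error has magnitude strictly less than b̄cc = p·δ. -/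
/-- The maximum gain error `gᵉ = (ā - 1) * (ηE - s^×)` satisfies
`gᵉ = -(1 - (1 - exp (-α*δ))/(α*δ)) * (p*δ)` and `-(p*δ) < gᵉ < 0`; that is, its
magnitude is strictly less than `b̄cc = p*δ`. -/
theorem max_gain_error
    (p α ηE δ tstar abar sx ge : ℝ)
    (hp : 0 < p) (hα : 0 < α) (hηE : 0 < ηE) (hδ : 0 < δ)
    (htstar : tstar = ηE / p)
    (habar : abar = Real.exp (-α * δ))
    (hsx : sx = p * δ / (Real.exp (-α * δ) - 1) + p * tstar + p / α)
    (hge : ge = (abar - 1) * (ηE - sx)) :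
    ge = -(1 - (1 - Real.exp (-α * δ)) / (α * δ)) * (p * δ) ∧
    -(p * δ) < ge ∧ ge < 0 := by
  have hαδ : 0 < α * δ := mul_pos hα hδ
  have hpδ : 0 < p * δ := mul_pos hp hδ
  have hlt : Real.exp (-α * δ) < 1 := Real.exp_lt_one_iff.2 (by linarith)
  have hgt : -α * δ + 1 < Real.exp (-α * δ) := Real.add_one_lt_exp (by linarith)
  have hformula : ge = -(1 - (1 - Real.exp (-α * δ)) / (α * δ)) * (p * δ) := by
    have hne : Real.exp (-α * δ) - 1 ≠ 0 := (sub_neg.2 hlt).ne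
    subst hge hsx habar htstar
    generalize Real.exp (-α * δ) = a at hne ⊢
    field_simp
    ring
  have hpos : 0 < (1 - Real.exp (-α * δ)) / (α * δ) := div_pos (by linarith) hαδ
  have hlt_one : (1 - Real.exp (-α * δ)) / (α * δ) < 1 := (div_lt_one hαδ).2 (by linarith)
  refine ⟨hformula, ?_, ?_⟩ <;> rw [hformula] <;> nlinarith
end

section
/- The derivative of f(z) = 1/(exp(−z) − 1) + 1/z is strictly negative on (0, ∞): for every z > 0, f′(z) = exp(−z)/(exp(−z) − 1)² − 1/z² < 0... equivalently, −exp(−z)·(−1)/(exp(−z) − 1)² − 1/z² < 0 for all z > 0. -/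
/-- The logarithmic mean inequality `z * exp (-z / 2) < 1 - exp (-z)`, which amounts to
`z / 2 < sinh (z / 2)`. -/
theorem mul_exp_neg_half_lt_one_sub_exp_neg {z : ℝ} (hz : 0 < z) :
    z * Real.exp (-(z / 2)) < 1 - Real.exp (-z) := by
  have h : z / 2 < Real.sinh (z / 2) := Real.self_lt_sinh_iff.2 (half_pos hz)
  rw [Real.sinh_eq] at h
  have hprod : Real.exp (z / 2) * Real.exp (-(z / 2)) = 1 := by
    rw [← Real.exp_add, add_neg_cancel, Real.exp_zero]
  have hsq : Real.exp (-z) = Real.exp (-(z / 2)) * Real.exp (-(z / 2)) := by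
    rw [← Real.exp_add]
    ring_nf
  rw [hsq, ← hprod, ← sub_mul]
  exact mul_lt_mul_of_pos_right (by linarith) (Real.exp_pos _)

/-- The derivative of `f z = 1/(exp (-z) - 1) + 1/z` is strictly negative on `(0, ∞)`:
for every `z > 0`, `f` has derivative `exp (-z)/(exp (-z) - 1)^2 - 1/z^2` at `z`, and
this derivative is strictly negative. -/
theorem f_deriv_neg (z : ℝ) (hz : 0 < z) :
    HasDerivAt (fun z : ℝ => 1 / (Real.exp (-z) - 1) + 1 / z)
      (Real.exp (-z) / (Real.exp (-z) - 1) ^ 2 - 1 / z ^ 2) z ∧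
    Real.exp (-z) / (Real.exp (-z) - 1) ^ 2 - 1 / z ^ 2 < 0 := by
  have hlt : Real.exp (-z) < 1 := by simpa using hz
  have hne : Real.exp (-z) - 1 ≠ 0 := (sub_neg.2 hlt).ne
  constructor
  · have hexp : HasDerivAt (fun z : ℝ => Real.exp (-z) - 1) (-Real.exp (-z)) z := by
      simpa using (hasDerivAt_neg z).exp.sub_const 1
    simp only [one_div]
    exact ((hexp.fun_inv hne).fun_add (hasDerivAt_inv hz.ne')).congr_deriv (by ring)
  · rw [sub_neg, div_lt_div_iff₀ (by positivity) (by positivity), one_mul]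
    calc Real.exp (-z) * z ^ 2 = (z * Real.exp (-(z / 2))) ^ 2 := by
          rw [mul_pow, ← Real.exp_nat_mul, mul_comm]
          ring_nf
      _ < (1 - Real.exp (-z)) ^ 2 :=
          pow_lt_pow_left₀ (mul_exp_neg_half_lt_one_sub_exp_neg hz) (by positivity) two_ne_zero
      _ = (Real.exp (-z) - 1) ^ 2 := by ring
end
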